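/- arXiv:1311.3096 — 3 statements merged into one kernel-verified Lean document; each statement's English description precedes it below -/
import Mathlib

section
/- For any integer n ≥ 6 and any simple graph G on n vertices with m edges, the least eigenvalue q_n(G) of the signless Laplacian matrix Q(G) = D(G) + A(G) satisfies q_n(G) ≥ 2m/(n-2) - n + 1. -/
open Matrix

/-- The signless Laplacian matrix `Q(G) = D(G) + A(G)` of a simple graph, over `ℝ`. -/
def SimpleGraph.signlessLap {V : Type*} [Fintype V] [DecidableEq V] (G : SimpleGraph V)
    [DecidableRel G.Adj] : Matrix V V ℝ :=
  G.degMatrix ℝ + G.adjMatrix ℝ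

set_option linter.unusedSectionVars false

namespace SLap

variable {V : Type*} [Fintype V] [DecidableEq V]

/-- twice the signless Laplacian form -/
noncomputable def F (H : SimpleGraph V) [DecidableRel H.Adj] (x : V → ℝ) : ℝ :=
  ∑ i, ∑ j, if H.Adj i j then (x i + x j) ^ 2 else 0

lemma F_nonneg (H : SimpleGraph V) [DecidableRel H.Adj] (x : V → ℝ) : 0 ≤ F H x := by
  unfold F
  refine Finset.sum_nonneg fun i _ => Finset.sum_nonneg fun j _ => ?_
  split_ifs <;> positivity

lemma sum_adj (H : SimpleGraph V) [DecidableRel H.Adj] (i : V) (f : V → ℝ) :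
    (∑ j, if H.Adj i j then f j else 0) = ∑ j ∈ H.neighborFinset i, f j := by
  rw [← Finset.sum_filter]
  congr 1
  ext j; simp

lemma F_le (H : SimpleGraph V) [DecidableRel H.Adj] (x : V → ℝ) (K : ℝ)
    (hK0 : 0 ≤ K)
    (hK : ∀ i j, H.Adj i j → (H.degree i : ℝ) + H.degree j ≤ K) :
    F H x ≤ 2 * K * ∑ i, x i ^ 2 := by
  have h1 : F H x ≤ ∑ i, ∑ j, ((if H.Adj i j then K * (x i ^ 2 / H.degree i) else 0)
      + (if H.Adj i j then K * (x j ^ 2 / H.degree j) else 0)) := by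
    unfold F
    refine Finset.sum_le_sum fun i _ => Finset.sum_le_sum fun j _ => ?_
    split_ifs with h
    · have hi : 0 < (H.degree i : ℝ) := by
        exact_mod_cast (H.degree_pos_iff_exists_adj i).2 ⟨j, h⟩
      have hj : 0 < (H.degree j : ℝ) := by
        exact_mod_cast (H.degree_pos_iff_exists_adj j).2 ⟨i, h.symm⟩
      have hk := hK i j h
      have hpos : 0 ≤ x i ^ 2 / H.degree i + x j ^ 2 / H.degree j := by positivity
      have h2 : (x i + x j) ^ 2 ≤ ((H.degree i : ℝ) + H.degree j) *
          (x i ^ 2 / H.degree i + x j ^ 2 / H.degree j) := by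
        have e : ((H.degree i : ℝ) + H.degree j) *
          (x i ^ 2 / H.degree i + x j ^ 2 / H.degree j) - (x i + x j) ^ 2
          = (H.degree j * x i - H.degree i * x j) ^ 2 / (H.degree i * H.degree j) := by
          field_simp; ring
        have : 0 ≤ (H.degree j * x i - H.degree i * x j) ^ 2 /
          ((H.degree i : ℝ) * H.degree j) := by positivity
        linarith
      nlinarith
    · simp
  have h3 : ∀ i, (∑ j, if H.Adj i j then K * (x i ^ 2 / H.degree i) else 0) ≤ K * x i ^ 2 := by
    intro i
    rw [sum_adj, Finset.sum_const, SimpleGraph.card_neighborFinset_eq_degree, nsmul_eq_mul]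
    rcases Nat.eq_zero_or_pos (H.degree i) with h | h
    · rw [h]; simp; positivity
    · have : (0:ℝ) < H.degree i := by exact_mod_cast h
      apply le_of_eq; field_simp
  have h4 : (∑ i, ∑ j, if H.Adj i j then K * (x j ^ 2 / H.degree j) else 0)
      = ∑ i, ∑ j, if H.Adj i j then K * (x i ^ 2 / H.degree i) else 0 := by
    rw [Finset.sum_comm]
    simp only [H.adj_comm]
  simp only [Finset.sum_add_distrib] at h1
  rw [h4] at h1
  have h5 := Finset.sum_le_sum fun i (_ : i ∈ Finset.univ) => h3 i
  rw [← Finset.mul_sum] at h5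
  linarith

lemma deg_add_le (H : SimpleGraph V) [DecidableRel H.Adj] {i j : V} (h : H.Adj i j) :
    H.degree i + H.degree j ≤ H.edgeFinset.card + 1 := by
  rw [← H.card_incidenceFinset_eq_degree, ← H.card_incidenceFinset_eq_degree,
    ← Finset.card_union_add_card_inter]
  have h1 : (H.incidenceFinset i ∪ H.incidenceFinset j).card ≤ H.edgeFinset.card :=
    Finset.card_le_card (Finset.union_subset (H.incidenceFinset_subset i)
      (H.incidenceFinset_subset j))
  have h2 : (H.incidenceFinset i ∩ H.incidenceFinset j).card ≤ 1 := by
    rw [← Finset.card_singleton s(i, j)]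
    apply Finset.card_le_card
    intro e he
    simp only [Finset.mem_inter, SimpleGraph.mem_incidenceFinset] at he
    have := H.incidenceSet_inter_incidenceSet_subset h.ne he
    simpa using this
  omega

lemma F_le_edges (H : SimpleGraph V) [DecidableRel H.Adj] (x : V → ℝ) :
    F H x ≤ 2 * (H.edgeFinset.card + 1) * ∑ i, x i ^ 2 := by
  apply F_le _ _ _ (by positivity)
  intro i j h
  exact_mod_cast deg_add_le H h

lemma F_le_deg (H : SimpleGraph V) [DecidableRel H.Adj] (x : V → ℝ) (D : ℕ)
    (hD : ∀ i, H.degree i ≤ D) :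
    F H x ≤ 2 * (2 * D) * ∑ i, x i ^ 2 := by
  apply F_le _ _ _ (by positivity)
  intro i j h
  have : H.degree i + H.degree j ≤ 2 * D := by have := hD i; have := hD j; omega
  exact_mod_cast this

lemma F_zero (H : SimpleGraph V) [DecidableRel H.Adj] (x : V → ℝ)
    (h : H.edgeFinset.card = 0) : F H x = 0 := by
  unfold F
  refine Finset.sum_eq_zero fun i _ => Finset.sum_eq_zero fun j _ => ?_
  rw [if_neg]
  intro hij
  rw [Finset.card_eq_zero] at h
  have : s(i, j) ∈ H.edgeFinset := by simpa using hij
  simp [h] at this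

lemma F_peel (H : SimpleGraph V) [DecidableRel H.Adj] (x : V → ℝ) (u : V) :
    F H x = 2 * (∑ j ∈ H.neighborFinset u, (x u + x j) ^ 2) + F (H.deleteIncidenceSet u) x := by
  have key : ∀ i j, (if H.Adj i j then (x i + x j) ^ 2 else 0) =
      (if i = u then (if H.Adj u j then (x u + x j) ^ 2 else 0) else 0)
      + (if j = u then (if H.Adj u i then (x u + x i) ^ 2 else 0) else 0)
      + (if (H.deleteIncidenceSet u).Adj i j then (x i + x j) ^ 2 else 0) := by
    intro i j
    simp only [SimpleGraph.deleteIncidenceSet_adj]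
    by_cases hi : i = u
    · subst hi
      by_cases hj : j = i
      · subst hj; simp
      · simp [hj]
    · by_cases hj : j = u
      · subst hj
        simp [hi, H.adj_comm, add_comm]
      · simp [hi, hj]
  unfold F
  rw [Finset.sum_congr rfl fun i _ => Finset.sum_congr rfl fun j _ => key i j]
  simp only [Finset.sum_add_distrib]
  rw [← sum_adj]
  have h1 : (∑ i, ∑ j, if i = u then (if H.Adj u j then (x u + x j) ^ 2 else 0) else 0)
     = ∑ j, if H.Adj u j then (x u + x j) ^ 2 else 0 := by
    rw [Finset.sum_comm]; simp
  have h2 : (∑ i, ∑ j, if j = u then (if H.Adj u i then (x u + x i) ^ 2 else 0) else 0)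
     = ∑ j, if H.Adj u j then (x u + x j) ^ 2 else 0 := by
    simp
  rw [h1, h2]; ring

lemma F_delete_congr (H : SimpleGraph V) [DecidableRel H.Adj] (x : V → ℝ) (u : V) :
    F (H.deleteIncidenceSet u) x = F (H.deleteIncidenceSet u) (Function.update x u 0) := by
  unfold F
  refine Finset.sum_congr rfl fun i _ => Finset.sum_congr rfl fun j _ => ?_
  split_ifs with h
  · rw [SimpleGraph.deleteIncidenceSet_adj] at h
    simp [Function.update_of_ne h.2.1, Function.update_of_ne h.2.2]
  · rfl

lemma lemA (H : SimpleGraph V) [DecidableRel H.Adj] (x : V → ℝ) (u : V) (r T : ℝ)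
    (hr : ∀ y : V → ℝ, F (H.deleteIncidenceSet u) y ≤ 2 * r * ∑ i, y i ^ 2)
    (h1 : r + 1 ≤ T) (h2 : (H.degree u : ℝ) - 1 ≤ T)
    (h3 : (Fintype.card V : ℝ) - 1 - H.degree u ≤ (T - (H.degree u - 1)) * (T - r)) :
    F H x ≤ 2 * (T * (∑ i, x i ^ 2) + (∑ i, x i) ^ 2) := by
  set N := H.neighborFinset u with hN
  have huN : u ∉ N := by simp [hN]
  set Z := (insert u N)ᶜ with hZ
  have split : ∀ f : V → ℝ, ∑ i, f i = f u + ∑ i ∈ N, f i + ∑ i ∈ Z, f i := by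
    intro f
    rw [← Finset.sum_add_sum_compl (insert u N) f, Finset.sum_insert huN]
  have hdN : (N.card : ℝ) = H.degree u := by simp [hN]
  have hk : (Z.card : ℝ) = Fintype.card V - 1 - H.degree u := by
    have := split (fun _ => 1)
    simp only [Finset.sum_const, nsmul_eq_mul, mul_one, Finset.card_univ] at this
    rw [← hdN]; linarith
  have hF := hr (Function.update x u 0)
  rw [← F_delete_congr, split] at hF
  have e1 : ∑ i ∈ N, (Function.update x u 0 i) ^ 2 = ∑ i ∈ N, x i ^ 2 := by
    refine Finset.sum_congr rfl fun i hi => ?_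
    rw [Function.update_of_ne]
    rintro rfl; exact huN hi
  have e2 : ∑ i ∈ Z, (Function.update x u 0 i) ^ 2 = ∑ i ∈ Z, x i ^ 2 := by
    refine Finset.sum_congr rfl fun i hi => ?_
    rw [Function.update_of_ne]
    rintro rfl; simp [hZ] at hi
  rw [e1, e2, Function.update_self] at hF
  rw [F_peel H x u, split, split]
  have e3 : ∑ j ∈ N, (x u + x j) ^ 2 = H.degree u * x u ^ 2 + 2 * x u * (∑ j ∈ N, x j)
      + ∑ j ∈ N, x j ^ 2 := by
    rw [← hdN, Finset.mul_sum, ← nsmul_eq_mul, ← Finset.sum_const, ← Finset.sum_add_distrib,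
      ← Finset.sum_add_distrib]
    refine Finset.sum_congr rfl fun i hi => ?_
    ring
  rw [e3]
  have cs : (∑ i ∈ Z, x i) ^ 2 ≤ Z.card * ∑ i ∈ Z, x i ^ 2 := sq_sum_le_card_mul_sum_sq
  rw [hk] at cs
  have hY : 0 ≤ ∑ i ∈ N, x i ^ 2 := Finset.sum_nonneg fun i _ => sq_nonneg _
  have hZ0 : 0 ≤ ∑ i ∈ Z, x i ^ 2 := Finset.sum_nonneg fun i _ => sq_nonneg _
  generalize (∑ i ∈ N, x i ^ 2) = Y at *
  generalize (∑ i ∈ Z, x i ^ 2) = W at *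
  generalize (∑ i ∈ N, x i) = s at *
  generalize (∑ i ∈ Z, x i) = z at *
  generalize x u = a at *
  generalize (H.degree u : ℝ) = d at *
  -- main inequality
  have main : 0 ≤ (T - (d - 1)) * a ^ 2 + 2 * a * z + (T - r) * W := by
    have hb : 0 < T - r := by linarith
    have hz : z ^ 2 ≤ (T - (d - 1)) * (T - r) * W := by nlinarith
    have hA : 0 ≤ T - (d - 1) := by linarith
    rcases hA.eq_or_lt with h0 | h0
    · rw [← h0] at hz ⊢
      have : z = 0 := by nlinarith [sq_nonneg z]
      subst this; nlinarith
    · have : 0 ≤ (T - (d - 1)) * ((T - (d - 1)) * a ^ 2 + 2 * a * z + (T - r) * W) := by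
        nlinarith [sq_nonneg ((T - (d - 1)) * a + z)]
      exact nonneg_of_mul_nonneg_right this h0
  nlinarith [mul_nonneg (by linarith : 0 ≤ T - r - 1) hY, sq_nonneg (s + z)]

lemma P1 (u v w p q r : ℝ) : (u+v)^2+(u+w)^2+(v+w)^2 ≤
    3*(u^2+v^2+w^2+p^2+q^2+r^2)+(u+v+w+p+q+r)^2 := by
  nlinarith [sq_nonneg ((1/4)*u+(1/4)*v+(1/4)*w+(1/4)*p+(1/4)*q+(1)*r), sq_nonneg ((1/5)*u+(1/5)*v+(1/5)*w+(1/5)*p+(1)*q), sq_nonneg ((1/6)*u+(1/6)*v+(1/6)*w+(1)*p), sq_nonneg ((-1/3)*u+(-1/3)*v+(1)*w), sq_nonneg ((-1/2)*u+(1)*v), sq_nonneg ((1)*u)]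

lemma P2 (u v w p q r : ℝ) : (u+v)^2+(u+w)^2+(v+p)^2 ≤
    3*(u^2+v^2+w^2+p^2+q^2+r^2)+(u+v+w+p+q+r)^2 := by
  nlinarith [sq_nonneg ((1/4)*u+(1/4)*v+(1/4)*w+(1/4)*p+(1/4)*q+(1)*r), sq_nonneg ((1/5)*u+(1/5)*v+(1/5)*w+(1/5)*p+(1)*q), sq_nonneg ((3/13)*u+(-2/13)*v+(3/13)*w+(1)*p), sq_nonneg ((-7/32)*u+(9/32)*v+(1)*w), sq_nonneg ((-5/43)*u+(1)*v), sq_nonneg ((1)*u)]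

lemma P3 (u v w p q r : ℝ) : (u+v)^2+(u+w)^2+(p+q)^2 ≤
    3*(u^2+v^2+w^2+p^2+q^2+r^2)+(u+v+w+p+q+r)^2 := by
  nlinarith [sq_nonneg ((1/4)*u+(1/4)*v+(1/4)*w+(1/4)*p+(1/4)*q+(1)*r), sq_nonneg ((3/11)*u+(3/11)*v+(3/11)*w+(-1/11)*p+(1)*q), sq_nonneg ((3/10)*u+(3/10)*v+(3/10)*w+(1)*p), sq_nonneg ((-7/23)*u+(3/23)*v+(1)*w), sq_nonneg ((-7/26)*u+(1)*v), sq_nonneg ((1)*u)]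

lemma P4 (u v w p q r : ℝ) : (u+v)^2+(u+w)^2+((p+v)^2+(p+w)^2) ≤
    7/2*(u^2+v^2+w^2+p^2+q^2+r^2)+(u+v+w+p+q+r)^2 := by
  nlinarith [sq_nonneg ((2/9)*u+(2/9)*v+(2/9)*w+(2/9)*p+(2/9)*q+(1)*r), sq_nonneg ((2/11)*u+(2/11)*v+(2/11)*w+(2/11)*p+(1)*q), sq_nonneg ((14/47)*u+(-8/47)*v+(-8/47)*w+(1)*p), sq_nonneg ((-8/65)*u+(18/65)*v+(1)*w), sq_nonneg ((-8/83)*u+(1)*v), sq_nonneg ((1)*u)]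

lemma P5 (u v w p q r : ℝ) : (u+v)^2+(u+w)^2+((p+v)^2+(p+q)^2) ≤
    7/2*(u^2+v^2+w^2+p^2+q^2+r^2)+(u+v+w+p+q+r)^2 := by
  nlinarith [sq_nonneg ((2/9)*u+(2/9)*v+(2/9)*w+(2/9)*p+(2/9)*q+(1)*r), sq_nonneg ((14/59)*u+(14/59)*v+(14/59)*w+(-4/59)*p+(1)*q), sq_nonneg ((98/267)*u+(-20/267)*v+(98/267)*w+(1)*p), sq_nonneg ((-380/1489)*u+(350/1489)*v+(1)*w), sq_nonneg ((-528/5737)*u+(1)*v), sq_nonneg ((1)*u)]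

lemma P6 (u v w p q r : ℝ) : (u+v)^2+(u+w)^2+((p+q)^2+(p+r)^2) ≤
    7/2*(u^2+v^2+w^2+p^2+q^2+r^2)+(u+v+w+p+q+r)^2 := by
  nlinarith [sq_nonneg ((2/7)*u+(2/7)*v+(2/7)*w+(2/7)*q+(1)*r), sq_nonneg ((2/9)*u+(2/9)*v+(2/9)*w+(1)*q), sq_nonneg ((2/5)*u+(2/5)*v+(2/5)*w+(1)*p), sq_nonneg ((-76/239)*u+(14/239)*v+(1)*w), sq_nonneg ((-76/253)*u+(1)*v), sq_nonneg ((1)*u)]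

/-- labelling of six vertices -/
lemma labels (H : SimpleGraph V) [DecidableRel H.Adj] (hV : Fintype.card V = 6) (u : V)
    (hu : H.degree u = 2) : ∃ v w p q r : V, H.neighborFinset u = {v, w} ∧ v ≠ w ∧
      (∀ a, a = u ∨ a = v ∨ a = w ∨ a = p ∨ a = q ∨ a = r) ∧
      (∀ f : V → ℝ, ∑ i, f i = f u + f v + f w + f p + f q + f r) := by
  rw [← H.card_neighborFinset_eq_degree] at hu
  obtain ⟨v, w, hvw, hN⟩ := Finset.card_eq_two.1 hu
  have huN : u ∉ H.neighborFinset u := by simp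
  have hc : ((insert u (H.neighborFinset u))ᶜ).card = 3 := by
    rw [Finset.card_compl, Finset.card_insert_of_notMem huN]; omega
  obtain ⟨p, q, r, hpq, hpr, hqr, hZ⟩ := Finset.card_eq_three.1 hc
  refine ⟨v, w, p, q, r, hN, hvw, ?_, ?_⟩
  · intro a
    by_cases ha : a ∈ insert u (H.neighborFinset u)
    · rw [hN] at ha; simp at ha; tauto
    · rw [← Finset.mem_compl, hZ] at ha; simp at ha; tauto
  · intro f
    rw [← Finset.sum_add_sum_compl (insert u (H.neighborFinset u)) f, Finset.sum_insert huN, hZ, hN,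
      Finset.sum_pair hvw, Finset.sum_insert (by simp [hpq, hpr]), Finset.sum_pair hqr]
    ring

lemma exists_edge (H : SimpleGraph V) [DecidableRel H.Adj] (h : H.edgeFinset.card ≠ 0) :
    ∃ a b, H.Adj a b := by
  rw [Finset.card_ne_zero] at h
  obtain ⟨e, he⟩ := h
  induction e with
  | h a b => exact ⟨a, b, by simpa using he⟩

set_option maxHeartbeats 1000000 in
lemma six3 (H : SimpleGraph V) [DecidableRel H.Adj] (hV : Fintype.card V = 6) (u : V)
    (hu : H.degree u = 2) (he : H.edgeFinset.card = 3) (x : V → ℝ) :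
    F H x ≤ 2 * (3 * (∑ i, x i ^ 2) + (∑ i, x i) ^ 2) := by
  obtain ⟨v, w, p, q, r, hN, hvw, hall, hsum⟩ := labels H hV u hu
  have h1 := H.card_edgeFinset_deleteIncidenceSet u
  obtain ⟨c, s, hcs⟩ := exists_edge (H.deleteIncidenceSet u) (by omega)
  have hd : (H.deleteIncidenceSet u).degree c = 1 := by
    have h2 := (H.deleteIncidenceSet u).degree_le_card_edgeFinset c
    have h3 : 0 < (H.deleteIncidenceSet u).degree c := ((H.deleteIncidenceSet u).degree_pos_iff_exists_adj c).2 ⟨s, hcs⟩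
    omega
  have hNc : (H.deleteIncidenceSet u).neighborFinset c = {s} := by
    rw [← (H.deleteIncidenceSet u).card_neighborFinset_eq_degree] at hd
    obtain ⟨t, ht⟩ := Finset.card_eq_one.1 hd
    have : s ∈ (H.deleteIncidenceSet u).neighborFinset c := by simpa using hcs
    rw [ht] at this ⊢
    simp at this; rw [this]
  have h2 := (H.deleteIncidenceSet u).card_edgeFinset_deleteIncidenceSet c
  have hcs' := hcs
  rw [SimpleGraph.deleteIncidenceSet_adj] at hcs'
  obtain ⟨ha, hcu, hsu⟩ := hcs'
  have hne := ha.ne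
  rw [F_peel H x u, F_peel (H.deleteIncidenceSet u) x c, F_zero _ x (by omega), hN, hNc, Finset.sum_pair hvw,
    Finset.sum_singleton, hsum, hsum]
  have key : (x u + x v)^2 + (x u + x w)^2 + (x c + x s)^2 ≤
    3 * (x u ^ 2 + x v ^ 2 + x w ^ 2 + x p ^ 2 + x q ^ 2 + x r ^ 2) +
      (x u + x v + x w + x p + x q + x r) ^ 2 := by
    generalize hu' : x u = u'
    generalize hv' : x v = v'
    generalize hw' : x w = w'
    generalize hp' : x p = p'
    generalize hq' : x q = q'
    generalize hr' : x r = r'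
    rcases hall c with rfl | rfl | rfl | rfl | rfl | rfl <;>
    rcases hall s with rfl | rfl | rfl | rfl | rfl | rfl <;>
    first
    | exact absurd rfl hne
    | exact absurd rfl hcu
    | exact absurd rfl hsu
    | (simp only [hu', hv', hw', hp', hq', hr']
       first
       | linarith [P1 u' v' w' p' q' r']
       | linarith [P2 u' v' w' p' q' r']
       | linarith [P2 u' v' w' q' p' r']
       | linarith [P2 u' v' w' r' p' q']
       | linarith [P2 u' w' v' p' q' r']
       | linarith [P2 u' w' v' q' p' r']
       | linarith [P2 u' w' v' r' p' q']
       | linarith [P3 u' v' w' p' q' r']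
       | linarith [P3 u' v' w' p' r' q']
       | linarith [P3 u' v' w' q' r' p'])
  linarith

set_option maxHeartbeats 1000000 in
lemma six4 (H : SimpleGraph V) [DecidableRel H.Adj] (hV : Fintype.card V = 6) (u : V)
    (hu : H.degree u = 2) (hD : ∀ i, H.degree i ≤ 2) (he : H.edgeFinset.card = 4) (x : V → ℝ) :
    F H x ≤ 2 * (7 / 2 * (∑ i, x i ^ 2) + (∑ i, x i) ^ 2) := by
  have h1 := H.card_edgeFinset_deleteIncidenceSet u
  by_cases hD1 : ∀ i, (H.deleteIncidenceSet u).degree i ≤ 1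
  · apply lemA H x u 2 (7/2)
    · intro y
      have := F_le_deg _ y 1 hD1
      simpa using this
    · norm_num
    · rw [hu]; norm_num
    · rw [hu, hV]; norm_num
  obtain ⟨v, w, p, q, r, hN, hvw, hall, hsum⟩ := labels H hV u hu
  push Not at hD1
  obtain ⟨c, hc⟩ := hD1
  have hle : ∀ i, (H.deleteIncidenceSet u).degree i ≤ H.degree i := fun i =>
    SimpleGraph.degree_le_of_le (H.deleteIncidenceSet_le u)
  have hc2 : (H.deleteIncidenceSet u).degree c = 2 := by have := hle c; have := hD c; omega
  have hcH : H.degree c = 2 := by have := hle c; have := hD c; omega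
  have hsub : (H.deleteIncidenceSet u).neighborFinset c = H.neighborFinset c := by
    apply Finset.eq_of_subset_of_card_le
    · intro j hj
      simp only [SimpleGraph.mem_neighborFinset] at hj ⊢
      exact H.deleteIncidenceSet_le u hj
    · simp [hc2, hcH]
  have huc : ¬ H.Adj c u := by
    intro h
    have : u ∈ (H.deleteIncidenceSet u).neighborFinset c := by rw [hsub]; simpa using h
    simp [SimpleGraph.deleteIncidenceSet_adj] at this
  have hc2' := hc2
  rw [← (H.deleteIncidenceSet u).card_neighborFinset_eq_degree] at hc2'
  obtain ⟨s, t, hst, hNc⟩ := Finset.card_eq_two.1 hc2'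
  have hs : (H.deleteIncidenceSet u).Adj c s := by rw [← SimpleGraph.mem_neighborFinset, hNc]; simp
  have ht : (H.deleteIncidenceSet u).Adj c t := by rw [← SimpleGraph.mem_neighborFinset, hNc]; simp
  have hcv : c ≠ v := by
    rintro rfl
    have : c ∈ H.neighborFinset u := by rw [hN]; simp
    exact huc (by simpa [H.adj_comm] using this)
  have hcw : c ≠ w := by
    rintro rfl
    have : c ∈ H.neighborFinset u := by rw [hN]; simp
    exact huc (by simpa [H.adj_comm] using this)
  have h2 := (H.deleteIncidenceSet u).card_edgeFinset_deleteIncidenceSet c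
  have hs1 := hs.ne
  have ht1 := ht.ne
  rw [SimpleGraph.deleteIncidenceSet_adj] at hs ht
  obtain ⟨-, hcu, hsu⟩ := hs
  obtain ⟨-, -, htu⟩ := ht
  rw [F_peel H x u, F_peel (H.deleteIncidenceSet u) x c, F_zero _ x (by omega), hN, hNc, Finset.sum_pair hvw,
    Finset.sum_pair hst, hsum, hsum]
  have key : (x u + x v)^2 + (x u + x w)^2 + ((x c + x s)^2 + (x c + x t)^2) ≤
    7 / 2 * (x u ^ 2 + x v ^ 2 + x w ^ 2 + x p ^ 2 + x q ^ 2 + x r ^ 2) +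
      (x u + x v + x w + x p + x q + x r) ^ 2 := by
    have gen : ∀ a b d : V, (∀ i, i = u ∨ i = v ∨ i = w ∨ i = a ∨ i = b ∨ i = d) → c = a →
      (x u + x v)^2 + (x u + x w)^2 + ((x c + x s)^2 + (x c + x t)^2) ≤
      7 / 2 * (x u ^ 2 + x v ^ 2 + x w ^ 2 + x a ^ 2 + x b ^ 2 + x d ^ 2) +
      (x u + x v + x w + x a + x b + x d) ^ 2 := by
      intro a b d hall hca
      subst hca
      generalize hu' : x u = u'
      generalize hv' : x v = v'
      generalize hw' : x w = w'
      generalize hp' : x c = p'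
      generalize hq' : x b = q'
      generalize hr' : x d = r'
      rcases hall s with h | h | h | h | h | h <;>
      rcases hall t with h' | h' | h' | h' | h' | h' <;>
      first
      | exact absurd (h.trans h'.symm) hst
      | exact absurd h hsu
      | exact absurd h' htu
      | exact absurd h.symm hs1
      | exact absurd h'.symm ht1
      | (simp only [h, h', hu', hv', hw', hp', hq', hr']
         first
         | linarith [P4 u' v' w' p' q' r']
         | linarith [P5 u' v' w' p' q' r']
         | linarith [P5 u' v' w' p' r' q']
         | linarith [P5 u' w' v' p' q' r']
         | linarith [P5 u' w' v' p' r' q']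
         | linarith [P6 u' v' w' p' q' r'])
    rcases hall c with h | h | h | h | h | h
    · exact absurd h hcu
    · exact absurd h hcv
    · exact absurd h hcw
    · exact gen p q r hall h
    · linarith [gen q p r (fun i => by have := hall i; tauto) h]
    · linarith [gen r p q (fun i => by have := hall i; tauto) h]
  linarith

lemma mainH (H : SimpleGraph V) [DecidableRel H.Adj] (n e : ℕ) (hV : Fintype.card V = n)
    (h6 : 6 ≤ n) (he : H.edgeFinset.card = e) (hen : e + 2 ≤ n) (x : V → ℝ) (T : ℝ)
    (hT : T = n - 2 - 2 * (n - 1 - e) / (n - 2)) :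
    F H x ≤ 2 * (T * (∑ i, x i ^ 2) + (∑ i, x i) ^ 2) := by
  have hX : 0 ≤ ∑ i, x i ^ 2 := Finset.sum_nonneg fun i _ => sq_nonneg _
  have h6' : (6:ℝ) ≤ n := by exact_mod_cast h6
  have hen' : (e:ℝ) + 2 ≤ n := by exact_mod_cast hen
  have simple : ∀ K : ℝ, K ≤ T → F H x ≤ 2 * K * ∑ i, x i ^ 2 →
      F H x ≤ 2 * (T * (∑ i, x i ^ 2) + (∑ i, x i) ^ 2) := by
    intro K hK h
    nlinarith [sq_nonneg (∑ i, x i), mul_le_mul_of_nonneg_right hK hX]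
  have hn2 : (0:ℝ) < n - 2 := by linarith
  -- lower bounds for T
  have hTlow : ∀ a b : ℝ, 2 * (n - 1 - e) ≤ b * (n - 2) → n - 2 - b = a → a ≤ T := by
    intro a b h1 h2
    have : 2 * ((n:ℝ) - 1 - e) / (n - 2) ≤ b := by rwa [div_le_iff₀ hn2]
    linarith
  by_cases e0 : e = 0
  · apply simple 0
    · subst e0
      apply hTlow 0 (n - 2) _ (by ring)
      push_cast; nlinarith
    · rw [F_zero H x (by omega)]; simp
  have e1 : (1:ℝ) ≤ e := by exact_mod_cast Nat.one_le_iff_ne_zero.2 e0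
  by_cases hA : e + 5 ≤ n ∨ (e + 4 = n ∧ 8 ≤ n)
  · apply simple (e + 1)
    · rcases hA with h | ⟨h, h8⟩
      · have : (e:ℝ) + 5 ≤ n := by exact_mod_cast h
        apply hTlow _ (n - 2 - (e + 1)) _ (by ring)
        nlinarith
      · have : (e:ℝ) + 4 = n := by exact_mod_cast h
        have : (8:ℝ) ≤ n := by exact_mod_cast h8
        apply hTlow _ (n - 2 - (e + 1)) _ (by ring)
        nlinarith
    · rw [← he]; exact F_le_edges H x
  have : Nonempty V := Fintype.card_pos_iff.1 (by omega)
  obtain ⟨u, hu⟩ := H.exists_maximal_degree_vertex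
  have hD : ∀ i, H.degree i ≤ H.degree u := fun i => hu ▸ H.degree_le_maxDegree i
  have hdel := H.card_edgeFinset_deleteIncidenceSet u
  have hde := H.degree_le_card_edgeFinset u
  generalize hd : H.degree u = d at *
  have useA : ∀ r : ℝ, (r = e - d + 1 ∨ (r = 0 ∧ d = e)) → r + 1 ≤ T → (d : ℝ) - 1 ≤ T →
      (n : ℝ) - 1 - d ≤ (T - (d - 1)) * (T - r) →
      F H x ≤ 2 * (T * (∑ i, x i ^ 2) + (∑ i, x i) ^ 2) := by
    intro r hr h1 h2 h3
    apply lemA H x u r T _ h1 (by rw [hd]; exact h2) (by rw [hd, hV]; exact h3)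
    intro y
    rcases hr with hr | ⟨hr, hde'⟩
    · have := F_le_edges (H.deleteIncidenceSet u) y
      rw [hdel, Nat.cast_sub hde, he] at this
      rw [hr]; exact this
    · rw [F_zero _ y (by omega), hr]; simp
  have useD := F_le_deg H x d hD
  rw [he] at hde
  by_cases d1 : d ≤ 1
  · apply simple (2 * d) _ useD
    have : (d:ℝ) ≤ 1 := by exact_mod_cast d1
    have h4 : (n:ℝ) ≤ e + 4 := by
      have : n ≤ e + 4 := by omega
      exact_mod_cast this
    refine le_trans (by linarith) (hTlow 2 (n - 4) ?_ (by ring))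
    nlinarith
  have hcase : e + 2 = n ∨ e + 3 = n ∨ (n = 7 ∧ e = 3) ∨ (n = 6 ∧ e = 2) := by omega
  rcases hcase with h | h | ⟨h, h'⟩ | ⟨h, h'⟩
  · -- e = n - 2
    have hr : (e:ℝ) = n - 2 := by rw [← h]; push_cast; ring
    have hT' : T = n - 2 - 2 / (n - 2) := by rw [hT, hr]; ring
    have eps : 2 / ((n:ℝ) - 2) ≤ 1 / 2 := by rw [div_le_iff₀ hn2]; linarith
    have eps0 : 0 ≤ 2 / ((n:ℝ) - 2) := by positivity
    generalize 2 / ((n:ℝ) - 2) = ε at *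
    by_cases d3 : 3 ≤ d
    · have d3' : (3:ℝ) ≤ d := by exact_mod_cast d3
      by_cases hde' : d = e
      · have : (d:ℝ) = n - 2 := by rw [hde', hr]
        apply useA 0 (Or.inr ⟨rfl, hde'⟩)
        · linarith
        · linarith
        · rw [this, hT']; nlinarith
      · have : d + 1 ≤ e := by omega
        have hk : (d:ℝ) + 1 ≤ e := by exact_mod_cast this
        apply useA _ (Or.inl rfl)
        · linarith
        · linarith
        · rw [hT', hr]
          have a1 : (2:ℝ) - ε ≤ d - 1 - ε := by linarith
          have a2 : (0:ℝ) ≤ n - 1 - d - 2 := by linarith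
          nlinarith [mul_nonneg (by linarith : (0:ℝ) ≤ n - 1 - d - ε) (by linarith : (0:ℝ) ≤ d - 1 - ε - 3/2)]
    · have d2 : d = 2 := by omega
      by_cases h7 : 7 ≤ n
      · have : (7:ℝ) ≤ n := by exact_mod_cast h7
        apply simple _ _ useD
        rw [d2]; push_cast; linarith
      · have n6 : n = 6 := by omega
        have hT2 : T = 7 / 2 := by
          rw [hT, hr, n6]; norm_num
        rw [hT2]
        exact six4 H (by omega) u (by omega) (fun i => by have := hD i; omega) (by omega) x
  · -- e = n - 3
    have hr : (e:ℝ) = n - 3 := by rw [← h]; push_cast; ring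
    have hT' : T = n - 2 - 4 / (n - 2) := by rw [hT, hr]; ring
    have eps : 4 / ((n:ℝ) - 2) ≤ 1 := by rw [div_le_iff₀ hn2]; linarith
    have eps0 : 0 ≤ 4 / ((n:ℝ) - 2) := by positivity
    generalize 4 / ((n:ℝ) - 2) = ε at *
    have hk : (d:ℝ) ≤ e := by exact_mod_cast hde
    by_cases d3 : 3 ≤ d
    · have d3' : (3:ℝ) ≤ d := by exact_mod_cast d3
      apply useA _ (Or.inl rfl)
      · linarith
      · linarith
      · rw [hT', hr]
        nlinarith [mul_nonneg (by linarith : (0:ℝ) ≤ n - 1 - d - ε) (by linarith : (0:ℝ) ≤ d - ε - 2)]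
    · have d2 : d = 2 := by omega
      by_cases h7 : 7 ≤ n
      · have : (7:ℝ) ≤ n := by exact_mod_cast h7
        apply simple _ _ useD
        rw [d2]; push_cast; linarith
      · have n6 : n = 6 := by omega
        have hT2 : T = 3 := by
          rw [hT, hr, n6]; norm_num
        rw [hT2]
        exact six3 H (by omega) u (by omega) (by omega) x
  · have hT2 : T = 19 / 5 := by rw [hT, h, h']; norm_num
    have hd' : d = 2 ∨ d = 3 := by omega
    rcases hd' with hd' | hd' <;>
    · apply useA _ (Or.inl rfl) <;> rw [hT2, hd'] <;> (try rw [h']) <;> (try rw [h]) <;> norm_num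
  · have hT2 : T = 5 / 2 := by rw [hT, h, h']; norm_num
    have hd' : d = 2 := by omega
    apply useA 0 (Or.inr ⟨rfl, by omega⟩) <;> rw [hT2] <;> (try rw [hd']) <;> (try rw [h]) <;> norm_num

lemma form (G : SimpleGraph V) [DecidableRel G.Adj] (x : V → ℝ) :
    2 * (x ⬝ᵥ (G.signlessLap *ᵥ x)) = F G x := by
  have h1 : x ⬝ᵥ (G.signlessLap *ᵥ x) =
      ∑ i, ∑ j, if G.Adj i j then (x i ^ 2 + x i * x j) else 0 := by
    unfold SimpleGraph.signlessLap dotProduct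
    refine Finset.sum_congr rfl fun i _ => ?_
    rw [Matrix.add_mulVec, Pi.add_apply, SimpleGraph.degMatrix_mulVec_apply,
      SimpleGraph.adjMatrix_mulVec_apply, sum_adj, Finset.sum_add_distrib, Finset.sum_const,
      SimpleGraph.card_neighborFinset_eq_degree, nsmul_eq_mul, ← Finset.mul_sum]
    ring
  have h2 : (∑ i, ∑ j, if G.Adj i j then (x i ^ 2 + x i * x j) else 0) =
      ∑ i, ∑ j, if G.Adj i j then (x j ^ 2 + x j * x i) else 0 := by
    rw [Finset.sum_comm]
    simp only [G.adj_comm]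
  have h3 : 2 * (x ⬝ᵥ (G.signlessLap *ᵥ x)) =
      (∑ i, ∑ j, if G.Adj i j then (x i ^ 2 + x i * x j) else 0) +
      ∑ i, ∑ j, if G.Adj i j then (x j ^ 2 + x j * x i) else 0 := by
    rw [← h2, h1]; ring
  rw [h3, ← Finset.sum_add_distrib]
  unfold F
  refine Finset.sum_congr rfl fun i _ => ?_
  rw [← Finset.sum_add_distrib]
  refine Finset.sum_congr rfl fun j _ => ?_
  split_ifs <;> ring

lemma F_compl (G : SimpleGraph V) [DecidableRel G.Adj] (x : V → ℝ) :
    F G x + F Gᶜ x = 2 * (((Fintype.card V : ℝ) - 2) * (∑ i, x i ^ 2) + (∑ i, x i) ^ 2) := by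
  have key : F G x + F Gᶜ x + ∑ i, ∑ j, (if i = j then (x i + x j) ^ 2 else 0)
      = ∑ i, ∑ j, (x i + x j) ^ 2 := by
    unfold F
    rw [← Finset.sum_add_distrib, ← Finset.sum_add_distrib]
    refine Finset.sum_congr rfl fun i _ => ?_
    rw [← Finset.sum_add_distrib, ← Finset.sum_add_distrib]
    refine Finset.sum_congr rfl fun j _ => ?_
    by_cases hij : i = j
    · subst hij; simp
    · by_cases h : G.Adj i j <;> simp [h, hij]
  have e1 : ∑ i, ∑ j, (if i = j then (x i + x j) ^ 2 else 0) = 4 * ∑ i, x i ^ 2 := by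
    rw [Finset.mul_sum]
    refine Finset.sum_congr rfl fun i _ => ?_
    simp; ring
  have e2 : ∑ i, ∑ j, (x i + x j) ^ 2 =
      2 * ((Fintype.card V : ℝ) * (∑ i, x i ^ 2) + (∑ i, x i) ^ 2) := by
    have : ∀ i j, (x i + x j) ^ 2 = x i ^ 2 + x j ^ 2 + 2 * (x i * x j) := by intros; ring
    simp only [this, Finset.sum_add_distrib, Finset.sum_const, ← Finset.mul_sum, ← Finset.sum_mul,
      Finset.card_univ, nsmul_eq_mul]
    ring
  rw [e1, e2] at key
  linarith

lemma edges_compl (G : SimpleGraph V) [DecidableRel G.Adj] :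
    2 * G.edgeFinset.card + 2 * Gᶜ.edgeFinset.card + Fintype.card V
      = Fintype.card V * Fintype.card V := by
  rw [← SimpleGraph.sum_degrees_eq_twice_card_edges, ← SimpleGraph.sum_degrees_eq_twice_card_edges,
    ← Finset.sum_add_distrib]
  have : ∀ i, G.degree i + Gᶜ.degree i + 1 = Fintype.card V := by
    intro i
    have h1 := G.degree_compl i
    have h2 := G.degree_lt_card_verts i
    omega
  have h2 := Finset.sum_congr rfl fun i (_ : i ∈ (Finset.univ : Finset V)) => this i
  rw [Finset.sum_add_distrib] at h2
  simpa using h2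

end SLap

/-- For `n ≥ 6`, every eigenvalue of the signless Laplacian of a graph on `n` vertices
with `m` edges is at least `2m/(n-2) - n + 1`; in particular the least one is. -/
theorem signlessLap_least_eigenvalue_lower_bound
    {V : Type*} [Fintype V] [DecidableEq V] (G : SimpleGraph V) [DecidableRel G.Adj]
    (n : ℕ) (hn : Fintype.card V = n) (h6 : 6 ≤ n)
    (m : ℕ) (hm : G.edgeFinset.card = m) :
    ∀ μ ∈ spectrum ℝ G.signlessLap,
      2 * (m : ℝ) / ((n : ℝ) - 2) - (n : ℝ) + 1 ≤ μ := by
  intro μ hμ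
  rw [← Matrix.spectrum_toLin', ← Module.End.hasEigenvalue_iff_mem_spectrum] at hμ
  obtain ⟨x, hx⟩ := hμ.exists_hasEigenvector
  have hxe : G.signlessLap *ᵥ x = μ • x := by simpa using hx.apply_eq_smul
  have hx0 : x ≠ 0 := hx.2
  have hX : 0 < ∑ i, x i ^ 2 := by
    have hne : ∃ i, x i ≠ 0 := by
      by_contra! h
      exact hx0 (funext h)
    obtain ⟨i, hi⟩ := hne
    exact Finset.sum_pos' (fun i _ => sq_nonneg _) ⟨i, Finset.mem_univ i, by positivity⟩
  have hF := SLap.form G x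
  have hdot : x ⬝ᵥ (μ • x) = μ * ∑ i, x i ^ 2 := by
    rw [dotProduct_smul, smul_eq_mul]
    congr 1
    unfold dotProduct
    exact Finset.sum_congr rfl fun i _ => by ring
  rw [hxe, hdot] at hF
  have hE := SLap.edges_compl G
  rw [hn, hm] at hE
  generalize he : Gᶜ.edgeFinset.card = e at hE
  have hE' : 2 * (m:ℝ) + 2 * e + n = n * n := by exact_mod_cast hE
  have h6' : (6:ℝ) ≤ n := by exact_mod_cast h6
  have hn2 : (0:ℝ) < n - 2 := by linarith
  have hT : (n:ℝ) - 2 - (2 * (m : ℝ) / ((n : ℝ) - 2) - (n : ℝ) + 1)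
      = n - 2 - 2 * (n - 1 - e) / (n - 2) := by
    have : 2 * (m:ℝ) = n * n - 2 * e - n := by linarith
    rw [this]; field_simp; ring
  by_cases hen : e + 2 ≤ n
  · have h1 := SLap.mainH Gᶜ n e hn h6 he hen x _ hT
    have h2 := SLap.F_compl G x
    rw [hn] at h2
    have : (2 * (m : ℝ) / ((n : ℝ) - 2) - (n : ℝ) + 1) * (∑ i, x i ^ 2) ≤ μ * ∑ i, x i ^ 2 := by
      nlinarith
    exact le_of_mul_le_mul_right this hX
  · have h0 := SLap.F_nonneg G x
    have hμ0 : 0 ≤ μ := by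
      by_contra! h
      nlinarith
    have : (n:ℝ) ≤ e + 1 := by
      have : n ≤ e + 1 := by omega
      exact_mod_cast this
    have h3 : 2 * ((n:ℝ) - 1 - e) / (n - 2) ≤ 0 :=
      div_nonpos_of_nonpos_of_nonneg (by linarith) hn2.le
    linarith
end

section
/- For any connected simple graph G on n ≥ 5 vertices with m edges, the least signless Laplacian eigenvalue satisfies q_n(G) ≥ 2m/(n-1) - n + 2. -/
open Matrix

namespace SLap

variable {V : Type*} [DecidableEq V]

def Qf (g : V → V → ℝ) (S : Finset V) (x : V → ℝ) : ℝ :=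
  ∑ i ∈ S, ∑ j ∈ S, g i j * (x i + x j) ^ 2

def dg (g : V → V → ℝ) (S : Finset V) (u : V) : ℝ := ∑ j ∈ S, g u j

def Mg (g : V → V → ℝ) (S : Finset V) : ℝ := ∑ i ∈ S, dg g S i

structure Good (g : V → V → ℝ) : Prop where
  symm : ∀ i j, g i j = g j i
  diag : ∀ i, g i i = 0
  val : ∀ i j, g i j = 0 ∨ g i j = 1

variable {g : V → V → ℝ}

lemma Good.nonneg (h : Good g) (i j : V) : 0 ≤ g i j := by
  rcases h.val i j with h | h <;> rw [h] <;> norm_num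

lemma Good.le_one (h : Good g) (i j : V) : g i j ≤ 1 := by
  rcases h.val i j with h | h <;> rw [h] <;> norm_num

lemma dbl_insert (f : V → V → ℝ) (hs : ∀ i j, f i j = f j i) (hd : ∀ i, f i i = 0)
    {u : V} {S : Finset V} (hu : u ∉ S) :
    ∑ i ∈ insert u S, ∑ j ∈ insert u S, f i j
      = ∑ i ∈ S, ∑ j ∈ S, f i j + 2 * ∑ j ∈ S, f u j := by
  rw [Finset.sum_insert hu]
  simp only [Finset.sum_insert hu, Finset.sum_add_distrib, hd]
  rw [Finset.sum_congr rfl (fun i _ => hs i u)]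
  ring

lemma Qf_insert (h : Good g) (x : V → ℝ) {u : V} {S : Finset V} (hu : u ∉ S) :
    Qf g (insert u S) x = Qf g S x + 2 * ∑ j ∈ S, g u j * (x u + x j) ^ 2 := by
  unfold Qf
  refine dbl_insert (fun i j => g i j * (x i + x j) ^ 2) ?_ ?_ hu
  · intro i j; beta_reduce; rw [h.symm i j]; ring
  · intro i; simp [h.diag]

lemma Mg_insert (h : Good g) {u : V} {S : Finset V} (hu : u ∉ S) :
    Mg g (insert u S) = Mg g S + 2 * dg g S u := by
  unfold Mg dg
  exact dbl_insert g h.symm h.diag hu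

lemma dg_insert_self (h : Good g) {u : V} {S : Finset V} (hu : u ∉ S) :
    dg g (insert u S) u = dg g S u := by
  unfold dg; rw [Finset.sum_insert hu, h.diag]; ring

lemma dg_nat (h : Good g) (S : Finset V) (u : V) : ∃ k : ℕ, dg g S u = k := by
  induction S using Finset.induction_on with
  | empty => exact ⟨0, by simp [dg]⟩
  | insert v S hv ih =>
    obtain ⟨k, hk⟩ := ih
    have : dg g (insert v S) u = g u v + dg g S u := by
      unfold dg; rw [Finset.sum_insert hv]
    rcases h.val u v with h | h
    · exact ⟨k, by rw [this, h, hk]; ring⟩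
    · exact ⟨k + 1, by rw [this, h, hk]; push_cast; ring⟩

lemma Mg_even (h : Good g) (S : Finset V) : ∃ k : ℕ, Mg g S = 2 * k := by
  induction S using Finset.induction_on with
  | empty => exact ⟨0, by simp [Mg]⟩
  | insert v S hv ih =>
    obtain ⟨k, hk⟩ := ih
    obtain ⟨l, hl⟩ := dg_nat h S v
    exact ⟨k + l, by rw [Mg_insert h hv, hk, hl]; push_cast; ring⟩

lemma dg_le (h : Good g) (S : Finset V) (u : V) : dg g S u ≤ S.card := by
  unfold dg
  calc _ ≤ ∑ j ∈ S, (1 : ℝ) := Finset.sum_le_sum (fun j _ => h.le_one u j)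
    _ = _ := by simp

lemma dg_le' (h : Good g) {S : Finset V} {u : V} (hu : u ∈ S) : dg g S u ≤ (S.card : ℝ) - 1 := by
  rw [← Finset.insert_erase hu, dg_insert_self h (Finset.notMem_erase u S),
    Finset.card_insert_of_notMem (Finset.notMem_erase u S)]
  have := dg_le h (S.erase u) u
  push_cast; linarith

lemma Qf_nonneg (h : Good g) (S : Finset V) (x : V → ℝ) : 0 ≤ Qf g S x :=
  Finset.sum_nonneg fun i _ => Finset.sum_nonneg fun j _ => mul_nonneg (h.nonneg i j) (sq_nonneg _)

lemma step (h : Good g) (x : V → ℝ) {u : V} {S : Finset V} (hu : u ∉ S) (c μ : ℝ)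
    (hc : 2 * c * ∑ i ∈ S, x i ^ 2 ≤ Qf g S x) (hd : 0 ≤ c - μ)
    (ha : μ * (1 + (c - μ)) ≤ dg g S u * (c - μ)) :
    2 * μ * ∑ i ∈ insert u S, x i ^ 2 ≤ Qf g (insert u S) x := by
  rw [Qf_insert h x hu, Finset.sum_insert hu]
  set δ := c - μ with hδ
  have h1 : ∀ j ∈ S, g u j * (δ / (1 + δ) * x u ^ 2) ≤
      g u j * (x u + x j) ^ 2 + δ * x j ^ 2 := by
    intro j _
    have h2 : δ / (1 + δ) * x u ^ 2 ≤ (x u + x j) ^ 2 + δ * x j ^ 2 := by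
      rw [div_mul_eq_mul_div, div_le_iff₀ (by linarith)]
      nlinarith [sq_nonneg (x u + (1 + δ) * x j)]
    rcases h.val u j with h | h <;> rw [h]
    · nlinarith [mul_nonneg hd (sq_nonneg (x j))]
    · linarith
  have h2 := Finset.sum_le_sum h1
  rw [← Finset.sum_mul, Finset.sum_add_distrib, ← Finset.mul_sum] at h2
  have h3 : μ * x u ^ 2 ≤ dg g S u * (δ / (1 + δ) * x u ^ 2) := by
    have : μ ≤ dg g S u * δ / (1 + δ) := by
      rw [le_div_iff₀ (by linarith)]; exact ha
    calc _ ≤ dg g S u * δ / (1 + δ) * x u ^ 2 := by gcongr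
      _ = _ := by ring
  unfold dg at h3
  have : c = δ + μ := by rw [hδ]; ring
  rw [this] at hc
  nlinarith

lemma direct (h : Good g) (x : V → ℝ) (S : Finset V) (D : ℝ)
    (hD : ∀ i ∈ S, (S.card : ℝ) - 1 - D ≤ dg g S i) :
    2 * ((S.card : ℝ) - 2 - 2 * D) * ∑ i ∈ S, x i ^ 2 ≤ Qf g S x := by
  -- pointwise lower bound
  have h1 : ∀ i ∈ S, ∀ j ∈ S, (2 * g i j - 1) * (x i ^ 2 + x j ^ 2)  + 2 * (x i * x j) ≤
      g i j * (x i + x j) ^ 2 := by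
    intro i _ j _
    rcases h.val i j with h | h <;> rw [h] <;> nlinarith [sq_nonneg (x i + x j), sq_nonneg (x i - x j)]
  have h2 : ∑ i ∈ S, ∑ j ∈ S, ((2 * g i j - 1) * (x i ^ 2 + x j ^ 2)  + 2 * (x i * x j)) ≤ Qf g S x :=
    Finset.sum_le_sum fun i hi => Finset.sum_le_sum fun j hj => h1 i hi j hj
  refine le_trans ?_ h2
  have e2 : ∑ i ∈ S, ∑ j ∈ S, 2 * (x i * x j) = 2 * (∑ i ∈ S, x i) ^ 2 := by
    rw [sq, Finset.sum_mul_sum, Finset.mul_sum]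
    simp only [Finset.mul_sum]
  have e3 : ∑ i ∈ S, ∑ j ∈ S, (2 * g i j - 1) * x i ^ 2
      = ∑ i ∈ S, (2 * dg g S i - S.card) * x i ^ 2 := by
    refine Finset.sum_congr rfl fun i _ => ?_
    rw [← Finset.sum_mul]
    congr 1
    rw [Finset.sum_sub_distrib, ← Finset.mul_sum]; simp [dg]
  have e4 : ∑ i ∈ S, ∑ j ∈ S, (2 * g i j - 1) * x j ^ 2
      = ∑ i ∈ S, (2 * dg g S i - S.card) * x i ^ 2 := by
    rw [Finset.sum_comm, ← e3]
    refine Finset.sum_congr rfl fun i _ => Finset.sum_congr rfl fun j _ => ?_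
    rw [h.symm i j]
  have e5 : ∑ i ∈ S, ((S.card : ℝ) - 2 - 2 * D) * x i ^ 2 ≤
      ∑ i ∈ S, (2 * dg g S i - S.card) * x i ^ 2 := by
    refine Finset.sum_le_sum fun i hi => ?_
    have := hD i hi
    exact mul_le_mul_of_nonneg_right (by linarith) (sq_nonneg _)
  rw [← Finset.mul_sum] at e5
  simp only [Finset.sum_sub_distrib, Finset.sum_add_distrib, mul_add] at *
  rw [e3, e4, e2]
  nlinarith [sq_nonneg (∑ i ∈ S, x i)]

/-- The arithmetic of the inductive step. -/
lemma arith (N Δ t : ℝ) (hN : 4 ≤ N) (hΔ : 2 ≤ Δ) (ht : 0 < t) (hta : t ≤ N - Δ) :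
    0 ≤ (2 - 2 * (N - t - Δ) / (N - 1)) - 2 * t / N ∧
    2 * t / N * (1 + ((2 - 2 * (N - t - Δ) / (N - 1)) - 2 * t / N)) ≤
      (N - Δ) * ((2 - 2 * (N - t - Δ) / (N - 1)) - 2 * t / N) := by
  have hN1 : 0 < N - 1 := by linarith
  have hN0 : 0 < N := by linarith
  have e : (2 - 2 * (N - t - Δ) / (N - 1)) - 2 * t / N
      = 2 * ((Δ - 1) * N + t) / (N * (N - 1)) := by
    field_simp; ring
  rw [e]
  set δ := 2 * ((Δ - 1) * N + t) / (N * (N - 1)) with hδ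
  have hδ0 : 0 ≤ δ := by
    apply div_nonneg <;> nlinarith
  refine ⟨hδ0, ?_⟩
  have hδ1 : 1 + δ ≤ Δ := by
    have : δ ≤ 2 * Δ / N := by
      rw [hδ, div_le_div_iff₀ (by positivity) hN0]
      have : (Δ - 1) * N + t ≤ Δ * (N - 1) := by linarith
      nlinarith [mul_le_mul_of_nonneg_right this (by positivity : (0:ℝ) ≤ 2 * N)]
    have : 2 * Δ / N ≤ Δ - 1 := by
      rw [div_le_iff₀ hN0]; nlinarith
    linarith
  calc 2 * t / N * (1 + δ) ≤ 2 * t / N * Δ := by gcongr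
    _ ≤ (N - Δ) * δ := by
      rw [hδ, ← mul_div_assoc, div_mul_eq_mul_div, div_le_div_iff₀ hN0 (by positivity)]
      have : t * Δ * (N - 1) ≤ (N - Δ) * ((Δ - 1) * N + t) := by
        nlinarith [mul_nonneg (sub_nonneg.2 hta) (by nlinarith : 0 ≤ (Δ - 1) * N)]
      nlinarith [mul_le_mul_of_nonneg_right this (by positivity : (0:ℝ) ≤ 2 * N)]

def Bd (g : V → V → ℝ) (S : Finset V) (x : V → ℝ) : Prop :=
  2 * (Mg g S / ((S.card : ℝ) - 1) - S.card + 2) * ∑ i ∈ S, x i ^ 2 ≤ Qf g S x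

lemma Mg_le (h : Good g) (S : Finset V) : Mg g S ≤ S.card * ((S.card : ℝ) - 1) := by
  unfold Mg
  calc _ ≤ ∑ i ∈ S, ((S.card : ℝ) - 1) := Finset.sum_le_sum fun i hi => dg_le' h hi
    _ = _ := by rw [Finset.sum_const, nsmul_eq_mul]

lemma Bd_triv (h : Good g) (x : V → ℝ) (S : Finset V) (hS : 2 ≤ S.card)
    (hM : Mg g S ≤ ((S.card : ℝ) - 1) * (S.card - 2)) : Bd g S x := by
  unfold Bd
  refine le_trans ?_ (Qf_nonneg h S x)
  apply mul_nonpos_of_nonpos_of_nonneg _ (Finset.sum_nonneg fun i _ => sq_nonneg _)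
  have : (2 : ℝ) ≤ S.card := by exact_mod_cast hS
  have : Mg g S / ((S.card : ℝ) - 1) ≤ S.card - 2 := by
    rw [div_le_iff₀ (by linarith)]; linarith
  linarith

lemma Bd_step (h : Good g) (x : V → ℝ) {u : V} {S : Finset V} (hu : u ∉ S) (hS : 4 ≤ S.card)
    (hd : dg g S u ≤ (S.card : ℝ) - 2) (hB : Bd g S x) : Bd g (insert u S) x := by
  have hc := Finset.card_insert_of_notMem hu
  have h4 : (4 : ℝ) ≤ S.card := by exact_mod_cast hS
  have hM := Mg_insert h hu
  have hcR : ((insert u S).card : ℝ) = S.card + 1 := by rw [hc]; push_cast; ring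
  by_cases ht : Mg g (insert u S) ≤ (((insert u S).card : ℝ) - 1) * ((insert u S).card - 2)
  · exact Bd_triv h x _ (by omega) ht
  push Not at ht
  rw [hcR] at ht
  have hMS := Mg_le h S
  set N : ℝ := (S.card : ℝ) with hN
  unfold Bd at hB ⊢
  rw [hcR]
  rw [← hN] at hB
  set M := Mg g S
  set a := dg g S u
  have := arith N (N - a) ((M + 2 * a - N * (N - 1)) / 2) h4 (by linarith) (by linarith)
    (by linarith)
  have e1 : (2 - 2 * (N - (M + 2 * a - N * (N - 1)) / 2 - (N - a)) / (N - 1))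
      = M / (N - 1) - N + 2 := by
    have : N - 1 ≠ 0 := by linarith
    field_simp; ring
  have e2 : 2 * ((M + 2 * a - N * (N - 1)) / 2) / N = (M + 2 * a) / (N + 1 - 1) - (N + 1) + 2 := by
    have : N ≠ 0 := by linarith
    have : N + 1 - 1 = N := by ring
    rw [this]
    field_simp; ring
  rw [e1, e2, show N - (N - a) = a by ring] at this
  rw [hM]
  exact step h x hu _ _ hB this.1 this.2

lemma sos1 (w p q r s : ℝ) :
    (w^2+p^2+q^2+r^2+s^2) ≤ 2 * ((w+r)^2+(w+s)^2+(p+r)^2+(p+s)^2+(q+r)^2+(q+s)^2+(r+s)^2) := by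
  nlinarith [sq_nonneg ((1)*w + (2/3)*r + (2/3)*s), sq_nonneg ((1)*p + (2/3)*r + (2/3)*s), sq_nonneg ((1)*q + (2/3)*r + (2/3)*s), sq_nonneg ((1)*r + (-2/3)*s), sq_nonneg ((1)*s)]
lemma sos2 (w p q r s : ℝ) :
    (w^2+p^2+q^2+r^2+s^2) ≤ 2 * ((w+r)^2+(w+s)^2+(p+r)^2+(p+s)^2+(q+r)^2+(q+s)^2+(p+q)^2) := by
  nlinarith [sq_nonneg ((1)*w + (2/3)*r + (2/3)*s), sq_nonneg ((1)*p + (2/5)*q + (2/5)*r + (2/5)*s), sq_nonneg ((1)*q + (2/7)*r + (2/7)*s), sq_nonneg ((1)*r + (-52/53)*s), sq_nonneg ((1)*s)]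
lemma sos3 (w p q r s : ℝ) :
    (w^2+p^2+q^2+r^2+s^2) ≤ 2 * ((w+r)^2+(w+s)^2+(p+q)^2+(p+s)^2+(q+r)^2+(q+s)^2+(r+s)^2) := by
  nlinarith [sq_nonneg ((1)*w + (2/3)*r + (2/3)*s), sq_nonneg ((1)*p + (2/3)*q + (2/3)*s), sq_nonneg ((1)*q + (6/11)*r + (2/11)*s), sq_nonneg ((1)*r + (2/17)*s), sq_nonneg ((1)*s)]
lemma sos4 (w p a b c : ℝ) :
    3 * (w^2+p^2+a^2+b^2+c^2) ≤ 2 * ((w+a)^2+(w+b)^2+(w+c)^2+(p+a)^2+(p+b)^2+(p+c)^2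
      +(a+b)^2+(a+c)^2+(b+c)^2) := by
  nlinarith [sq_nonneg ((1)*w + (2/3)*a + (2/3)*b + (2/3)*c), sq_nonneg ((1)*p + (2/3)*a + (2/3)*b + (2/3)*c), sq_nonneg ((1)*a + (-2/7)*b + (-2/7)*c), sq_nonneg ((1)*b + (-2/5)*c), sq_nonneg ((1)*c)]


lemma split_u (h : Good g) (S : Finset V) (u : V) :
    ∃ A B : Finset V, Disjoint A B ∧ A ∪ B = S ∧ (∀ j ∈ A, g u j = 0) ∧ (∀ j ∈ B, g u j = 1) ∧
      (B.card : ℝ) = dg g S u ∧ A.card + B.card = S.card := by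
  classical
  refine ⟨S.filter (fun j => g u j = 0), S.filter (fun j => ¬ g u j = 0),
    Finset.disjoint_filter_filter_not _ _ _, Finset.filter_union_filter_not_eq _ _, ?_, ?_, ?_, ?_⟩
  · intro j hj; exact (Finset.mem_filter.1 hj).2
  · intro j hj; exact (h.val u j).resolve_left (Finset.mem_filter.1 hj).2
  · rw [Finset.card_filter]
    unfold dg
    push_cast
    refine Finset.sum_congr rfl fun j _ => ?_
    rcases h.val u j with h | h <;> rw [h] <;> simp
  · exact Finset.card_filter_add_card_filter_not _

lemma expand4 (h : Good g) (x : V → ℝ) {p q r s : V} (hpq : p ≠ q) (hpr : p ≠ r) (hps : p ≠ s)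
    (hqr : q ≠ r) (hqs : q ≠ s) (hrs : r ≠ s) :
    Qf g {p, q, r, s} x = 2 * (g p q * (x p + x q) ^ 2 + g p r * (x p + x r) ^ 2
      + g p s * (x p + x s) ^ 2 + g q r * (x q + x r) ^ 2 + g q s * (x q + x s) ^ 2
      + g r s * (x r + x s) ^ 2) ∧
    Mg g {p, q, r, s} = 2 * (g p q + g p r + g p s + g q r + g q s + g r s) ∧
    ∀ f : V → ℝ, ∑ i ∈ ({p, q, r, s} : Finset V), f i = f p + f q + f r + f s := by
  have h1 : p ∉ ({q, r, s} : Finset V) := by simp [*]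
  have h2 : q ∉ ({r, s} : Finset V) := by simp [*]
  have h3 : r ∉ ({s} : Finset V) := by simp [*]
  refine ⟨?_, ?_, ?_⟩
  · rw [Qf_insert h x h1, Qf_insert h x h2, Qf_insert h x h3, Finset.sum_insert h2,
      Finset.sum_insert h3, Finset.sum_insert h3]
    simp [Qf, h.diag]; ring
  · rw [Mg_insert h h1, Mg_insert h h2, Mg_insert h h3]
    unfold dg
    rw [Finset.sum_insert h2, Finset.sum_insert h3, Finset.sum_insert h3]
    simp [Mg, dg, h.diag]; ring
  · intro f
    rw [Finset.sum_insert h1, Finset.sum_insert h2, Finset.sum_insert h3]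
    simp; ring

lemma special1 (h : Good g) (x : V → ℝ) {u : V} {S : Finset V} (hu : u ∉ S) (hS : S.card = 4)
    (hd : dg g S u = 2) (hM : Mg g S = 10) :
    ∑ i ∈ insert u S, x i ^ 2 ≤ Qf g (insert u S) x := by
  obtain ⟨A, B, hAB, hU, hA, hB, hc, hcc⟩ := split_u h S u
  have hB2 : B.card = 2 := by rw [hd] at hc; exact_mod_cast hc
  have hA2 : A.card = 2 := by omega
  obtain ⟨p, q, hpq, rfl⟩ := Finset.card_eq_two.1 hA2
  obtain ⟨r, s, hrs, rfl⟩ := Finset.card_eq_two.1 hB2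
  have hU' : S = {p, q, r, s} := by
    rw [← hU]; ext; simp only [Finset.mem_union, Finset.mem_insert, Finset.mem_singleton]; tauto
  simp only [Finset.disjoint_insert_left, Finset.disjoint_singleton_left, Finset.mem_insert,
    Finset.mem_singleton, not_or] at hAB
  obtain ⟨⟨hpr, hps⟩, hqr, hqs⟩ := hAB
  obtain ⟨e1, e2, e3⟩ := expand4 h x hpq hpr hps hqr hqs hrs
  rw [Qf_insert h x hu, Finset.sum_insert hu]
  rw [hU'] at hM ⊢
  rw [e1, e3, e3]
  rw [e2] at hM
  rw [hA p (by simp), hA q (by simp), hB r (by simp), hB s (by simp)]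
  have s1 := sos1 (x u) (x p) (x q) (x r) (x s)
  have s2 := sos2 (x u) (x p) (x q) (x r) (x s)
  have s3 := sos3 (x u) (x p) (x q) (x r) (x s)
  have s4 := sos3 (x u) (x q) (x p) (x r) (x s)
  have s5 := sos3 (x u) (x p) (x q) (x s) (x r)
  have s6 := sos3 (x u) (x q) (x p) (x s) (x r)
  rcases h.val p q with h1 | h1 <;> rcases h.val p r with h2 | h2 <;>
  rcases h.val p s with h3 | h3 <;> rcases h.val q r with h4 | h4 <;>
  rcases h.val q s with h5 | h5 <;> rcases h.val r s with h6 | h6 <;>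
  rw [h1, h2, h3, h4, h5, h6] at hM ⊢ <;> first | (exfalso; norm_num at hM; done) | linarith

lemma special2 (h : Good g) (x : V → ℝ) {u : V} {S : Finset V} (hu : u ∉ S) (hS : S.card = 4)
    (hd : dg g S u = 3) (hM : Mg g S = 12) :
    3 * ∑ i ∈ insert u S, x i ^ 2 ≤ Qf g (insert u S) x := by
  obtain ⟨A, B, hAB, hU, hA, hB, hc, hcc⟩ := split_u h S u
  have hB2 : B.card = 3 := by rw [hd] at hc; exact_mod_cast hc
  have hA2 : A.card = 1 := by omega
  obtain ⟨p, rfl⟩ := Finset.card_eq_one.1 hA2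
  obtain ⟨q, r, s, hqr, hqs, hrs, rfl⟩ := Finset.card_eq_three.1 hB2
  have hU' : S = {p, q, r, s} := by
    rw [← hU]; ext; simp only [Finset.mem_union, Finset.mem_insert, Finset.mem_singleton]
  simp only [Finset.disjoint_singleton_left, Finset.mem_insert,
    Finset.mem_singleton, not_or] at hAB
  obtain ⟨hpq, hpr, hps⟩ := hAB
  obtain ⟨e1, e2, e3⟩ := expand4 h x hpq hpr hps hqr hqs hrs
  rw [Qf_insert h x hu, Finset.sum_insert hu]
  rw [hU'] at hM ⊢
  rw [e1, e3, e3]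
  rw [e2] at hM
  rw [hA p (by simp), hB q (by simp), hB r (by simp), hB s (by simp)]
  have s1 := sos4 (x u) (x p) (x q) (x r) (x s)
  have h1 := h.le_one p q
  have h2 := h.le_one p r
  have h3 := h.le_one p s
  have h4 := h.le_one q r
  have h5 := h.le_one q s
  have h6 := h.le_one r s
  rw [show g p q = 1 by linarith, show g p r = 1 by linarith, show g p s = 1 by linarith,
    show g q r = 1 by linarith, show g q s = 1 by linarith, show g r s = 1 by linarith]
  linarith

lemma full (h : Good g) (S : Finset V) (hM : Mg g S = S.card * ((S.card : ℝ) - 1)) :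
    ∀ i ∈ S, (S.card : ℝ) - 1 ≤ dg g S i := by
  by_contra hcon
  push Not at hcon
  obtain ⟨i, hi, hlt⟩ := hcon
  have : Mg g S < ∑ i ∈ S, ((S.card : ℝ) - 1) :=
    Finset.sum_lt_sum (fun i hi => dg_le' h hi) ⟨i, hi, hlt⟩
  rw [Finset.sum_const, nsmul_eq_mul] at this
  linarith

lemma base5 (h : Good g) (x : V → ℝ) (S : Finset V) (hS : S.card = 5) : Bd g S x := by
  have hSR : (S.card : ℝ) = 5 := by exact_mod_cast hS
  by_cases ht : Mg g S ≤ 12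
  · exact Bd_triv h x S (by omega) (by rw [hSR]; linarith)
  push Not at ht
  have hX : 0 ≤ ∑ i ∈ S, x i ^ 2 := Finset.sum_nonneg fun i _ => sq_nonneg _
  obtain ⟨k, hk⟩ := Mg_even h S
  by_cases hu : ∃ u ∈ S, dg g S u ≤ 2
  · obtain ⟨u, huS, hd⟩ := hu
    have hn := Finset.notMem_erase u S
    have hc : (S.erase u).card = 4 := by rw [Finset.card_erase_of_mem huS, hS]
    have hcR : ((S.erase u).card : ℝ) = 4 := by exact_mod_cast hc
    have hi := Finset.insert_erase huS
    have hM := Mg_insert h hn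
    have hd' := dg_insert_self h hn
    rw [hi] at hM hd'
    obtain ⟨l, hl⟩ := Mg_even h (S.erase u)
    obtain ⟨a, ha⟩ := dg_nat h (S.erase u) u
    have hle := Mg_le h (S.erase u)
    rw [hcR] at hle
    have hl6 : l ≤ 6 := by
      have : (l : ℝ) ≤ 6 := by linarith
      exact_mod_cast this
    have ha2 : a ≤ 2 := by
      have : (a : ℝ) ≤ 2 := by linarith
      exact_mod_cast this
    have hsum : k = l + a := by
      have : (k : ℝ) = l + a := by linarith
      exact_mod_cast this
    have hk6 : 6 < k := by
      have : (6 : ℝ) < k := by linarith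
      exact_mod_cast this
    by_cases hl' : l = 6
    · rw [← hi]
      apply Bd_step h x hn (by omega) (by rw [hcR, ← hd']; linarith)
      have hM' : Mg g (S.erase u) = 12 := by rw [hl, hl']; norm_num
      have := direct h x (S.erase u) 0 (by
        have := full h (S.erase u) (by rw [hcR, hM']; norm_num)
        simpa using this)
      unfold Bd
      rw [hcR] at this ⊢
      rw [hM']
      norm_num at this ⊢
      exact this
    · have hl5 : l = 5 := by omega
      have ha2' : a = 2 := by omega
      have := special1 h x hn hc (by rw [ha, ha2']; norm_num) (by rw [hl, hl5]; norm_num)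
      rw [hi] at this
      unfold Bd
      rw [hSR, hk, hsum, hl5, ha2']
      norm_num
      exact this
  · push Not at hu
    have hu3 : ∀ i ∈ S, 3 ≤ dg g S i := by
      intro i hi
      obtain ⟨a, ha⟩ := dg_nat h S i
      have := hu i hi
      rw [ha] at this ⊢
      have : 2 < a := by exact_mod_cast this
      exact_mod_cast this
    by_cases h16 : Mg g S ≤ 16
    · have := direct h x S 1 (by intro i hi; rw [hSR]; linarith [hu3 i hi])
      unfold Bd
      refine le_trans ?_ this
      rw [hSR]
      apply mul_le_mul_of_nonneg_right _ hX
      linarith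
    by_cases h20 : Mg g S = 20
    · have := direct h x S 0 (by
        have := full h S (by rw [hSR, h20]; norm_num)
        simpa using this)
      unfold Bd
      refine le_trans ?_ this
      rw [hSR]
      apply mul_le_mul_of_nonneg_right _ hX
      linarith
    have hle := Mg_le h S
    rw [hSR] at hle
    have hk9 : k = 9 := by
      have h1 : (k : ℝ) ≤ 10 := by linarith
      have h2 : (8 : ℝ) < k := by linarith
      have h3 : k ≠ 10 := by rintro rfl; apply h20; rw [hk]; norm_num
      have h1 : k ≤ 10 := by exact_mod_cast h1
      have h2 : 8 < k := by exact_mod_cast h2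
      omega
    have hM18 : Mg g S = 18 := by rw [hk, hk9]; norm_num
    obtain ⟨u, huS, hd⟩ : ∃ u ∈ S, dg g S u < 4 := by
      by_contra hcon
      push Not at hcon
      have : ∑ i ∈ S, (4 : ℝ) ≤ Mg g S := Finset.sum_le_sum hcon
      rw [Finset.sum_const, nsmul_eq_mul, hSR] at this
      linarith
    have hn := Finset.notMem_erase u S
    have hc : (S.erase u).card = 4 := by rw [Finset.card_erase_of_mem huS, hS]
    have hi := Finset.insert_erase huS
    have hM := Mg_insert h hn
    have hd' := dg_insert_self h hn
    rw [hi] at hM hd'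
    obtain ⟨a, ha⟩ := dg_nat h (S.erase u) u
    have h3 := hu3 u huS
    rw [hd', ha] at hd h3
    have : a = 3 := by
      have h1 : a < 4 := by exact_mod_cast hd
      have h2 : 3 ≤ a := by exact_mod_cast h3
      omega
    rw [this] at ha
    norm_num at ha
    have := special2 h x hn hc ha (by linarith)
    rw [hi] at this
    unfold Bd
    rw [hSR, hM18]
    norm_num
    exact this

lemma main (h : Good g) (x : V → ℝ) (n : ℕ) (hn : 5 ≤ n) :
    ∀ S : Finset V, S.card = n → Bd g S x := by
  induction n, hn using Nat.le_induction with
  | base => exact fun S hS => base5 h x S hS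
  | succ n hn ih =>
    intro S hS
    have hSR : (S.card : ℝ) = n + 1 := by exact_mod_cast hS
    have hnR : (5 : ℝ) ≤ n := by exact_mod_cast hn
    by_cases hu : ∃ u ∈ S, dg g S u ≤ n - 2
    · obtain ⟨u, huS, hd⟩ := hu
      have hn' := Finset.notMem_erase u S
      have hc : (S.erase u).card = n := by rw [Finset.card_erase_of_mem huS, hS]; rfl
      have hi := Finset.insert_erase huS
      have hd' := dg_insert_self h hn'
      rw [hi] at hd'
      rw [← hi]
      exact Bd_step h x hn' (by omega) (by rw [hc, ← hd']; exact hd) (ih _ hc)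
    · push Not at hu
      have := direct h x S 1 (by
        intro i hi
        obtain ⟨a, ha⟩ := dg_nat h S i
        have := hu i hi
        rw [hSR]
        rw [ha] at this ⊢
        have h1 : (n : ℝ) < a + 2 := by linarith
        have h2 : n < a + 2 := by exact_mod_cast h1
        have h3 : n ≤ a + 1 := by omega
        have h4 : (n : ℝ) ≤ a + 1 := by exact_mod_cast h3
        linarith)
      unfold Bd
      refine le_trans ?_ this
      apply mul_le_mul_of_nonneg_right _ (Finset.sum_nonneg fun i _ => sq_nonneg _)
      have hle := Mg_le h S
      rw [hSR] at hle ⊢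
      have : Mg g S / ((n : ℝ) + 1 - 1) ≤ n + 1 := by
        rw [div_le_iff₀ (by linarith)]; exact hle
      linarith

end SLap

/-- Lima et al.'s conjecture: for a connected graph on `n ≥ 5` vertices with `m` edges,
every signless Laplacian eigenvalue (in particular the least) is at least `2m/(n-1) - n + 2`. -/
theorem signlessLap_least_eigenvalue_conjecture
    {V : Type*} [Fintype V] [DecidableEq V] (G : SimpleGraph V) [DecidableRel G.Adj]
    (hconn : G.Connected)
    (n : ℕ) (hn : Fintype.card V = n) (h5 : 5 ≤ n)
    (m : ℕ) (hm : G.edgeFinset.card = m) :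
    ∀ μ ∈ spectrum ℝ G.signlessLap,
      2 * (m : ℝ) / ((n : ℝ) - 1) - (n : ℝ) + 2 ≤ μ := by
  intro μ hμ
  rw [← Matrix.spectrum_toLin', ← Module.End.hasEigenvalue_iff_mem_spectrum] at hμ
  obtain ⟨x, hx⟩ := hμ.exists_hasEigenvector
  have hx1 : G.signlessLap *ᵥ x = μ • x := by
    have := hx.apply_eq_smul
    rwa [Matrix.toLin'_apply] at this
  have hx0 : x ≠ 0 := hx.2
  set g : V → V → ℝ := fun i j => if G.Adj i j then 1 else 0 with hg
  have hgood : SLap.Good g := by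
    refine ⟨fun i j => ?_, fun i => ?_, fun i j => ?_⟩
    · simp [hg, G.adj_comm]
    · simp [hg]
    · by_cases h : G.Adj i j <;> simp [hg, h]
  have hdg : ∀ i, SLap.dg g Finset.univ i = G.degree i := by
    intro i
    simp [SLap.dg, hg, ← G.card_neighborFinset_eq_degree, G.neighborFinset_eq_filter]
  have hM : SLap.Mg g Finset.univ = 2 * m := by
    unfold SLap.Mg
    simp only [hdg]
    have := G.sum_degrees_eq_twice_card_edges
    rw [hm] at this
    exact_mod_cast this
  have key := SLap.main hgood x n h5 Finset.univ (by rw [Finset.card_univ, hn])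
  unfold SLap.Bd at key
  rw [hM, Finset.card_univ, hn] at key
  have hrow : ∀ i, (G.degree i : ℝ) * x i + ∑ j, g i j * x j = μ * x i := by
    intro i
    have := congrFun hx1 i
    rw [SimpleGraph.signlessLap, Matrix.add_mulVec, Pi.add_apply] at this
    simp only [SimpleGraph.degMatrix, Matrix.mulVec_diagonal, Pi.smul_apply, smul_eq_mul] at this
    rw [← this]
    simp [Matrix.mulVec, dotProduct, hg, SimpleGraph.adjMatrix_apply]
  have hQ : SLap.Qf g Finset.univ x = 2 * μ * ∑ i, x i ^ 2 := by
    have e1 : ∑ i, ∑ j, g i j * x i ^ 2 = ∑ i, (G.degree i : ℝ) * x i ^ 2 := by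
      refine Finset.sum_congr rfl fun i _ => ?_
      rw [← Finset.sum_mul, ← hdg]; rfl
    have e2 : ∑ i, ∑ j, g i j * x j ^ 2 = ∑ i, (G.degree i : ℝ) * x i ^ 2 := by
      rw [Finset.sum_comm, ← e1]
      refine Finset.sum_congr rfl fun i _ => Finset.sum_congr rfl fun j _ => ?_
      rw [hgood.symm i j]
    have e3 : ∑ i, ∑ j, g i j * (x i * x j) = ∑ i, x i * ∑ j, g i j * x j := by
      refine Finset.sum_congr rfl fun i _ => ?_
      rw [Finset.mul_sum]
      exact Finset.sum_congr rfl fun j _ => by ring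
    have e4 : SLap.Qf g Finset.univ x = ∑ i, ∑ j, g i j * x i ^ 2 + ∑ i, ∑ j, g i j * x j ^ 2
        + 2 * ∑ i, ∑ j, g i j * (x i * x j) := by
      unfold SLap.Qf
      simp only [Finset.mul_sum, ← Finset.sum_add_distrib]
      exact Finset.sum_congr rfl fun i _ => Finset.sum_congr rfl fun j _ => by ring
    rw [e4, e1, e2, e3]
    have e5 : ∑ i, (G.degree i : ℝ) * x i ^ 2 + ∑ i, x i * ∑ j, g i j * x j
        = μ * ∑ i, x i ^ 2 := by
      rw [← Finset.sum_add_distrib, Finset.mul_sum]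
      refine Finset.sum_congr rfl fun i _ => ?_
      linear_combination x i * hrow i
    linarith
  rw [hQ] at key
  have hpos : 0 < ∑ i, x i ^ 2 := by
    obtain ⟨i, hi⟩ := Function.ne_iff.1 hx0
    exact Finset.sum_pos' (fun i _ => sq_nonneg _) ⟨i, Finset.mem_univ _, by
      have : x i ≠ 0 := hi
      positivity⟩
  have := le_of_mul_le_mul_right key hpos
  linarith
end

section
/- Let n ≥ 8 and let G be a simple graph on n vertices with m = (n-1)(n-2)/2 + r edges for some integer r with 1 ≤ r ≤ n-1. If G has at least r+1 vertices of degree n-1, then q_n(G) > 2r/(n-2). -/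
open Matrix

set_option maxHeartbeats 1000000 in
theorem signlessLap_least_eigenvalue_many_dominating
    {V : Type*} [Fintype V] [DecidableEq V] (G : SimpleGraph V) [DecidableRel G.Adj]
    (n : ℕ) (hn : Fintype.card V = n) (h8 : 8 ≤ n)
    (r : ℕ) (hr1 : 1 ≤ r) (hr2 : r ≤ n - 1)
    (hm : 2 * G.edgeFinset.card = (n - 1) * (n - 2) + 2 * r)
    (hk : r + 1 ≤ (Finset.univ.filter fun v => G.degree v = n - 1).card) :
    ∀ μ ∈ spectrum ℝ G.signlessLap, 2 * (r : ℝ) / ((n : ℝ) - 2) < μ := by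
  intro μ hμ
  obtain ⟨S, hS, hSc⟩ := Finset.exists_subset_card_eq hk
  rw [← Matrix.spectrum_toLin', ← Module.End.hasEigenvalue_iff_mem_spectrum] at hμ
  obtain ⟨x, hx⟩ := hμ.exists_hasEigenvector
  have hx0 := hx.2
  have hE : ∀ v, ∑ u, (if G.Adj v u then x v + x u else 0) = μ * x v := by
    intro v
    have h := congrFun hx.apply_eq_smul v
    simp only [Matrix.toLin'_apply, SimpleGraph.signlessLap, Matrix.add_mulVec, Pi.add_apply,
      Pi.smul_apply, smul_eq_mul, SimpleGraph.degMatrix, Matrix.mulVec_diagonal,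
      SimpleGraph.adjMatrix_mulVec_apply] at h
    rw [← h, ← Finset.sum_filter, Finset.sum_add_distrib, Finset.sum_const,
      ← SimpleGraph.neighborFinset_eq_filter]
    simp
  have hadj : ∀ v ∈ S, ∀ u, u ≠ v → G.Adj v u := by
    intro v hv u huv
    have h1 := (Finset.mem_filter.1 (hS hv)).2
    rw [← hn] at h1
    have : G.neighborFinset v = Finset.univ.erase v := by
      apply Finset.eq_of_subset_of_card_le
      · intro w hw
        simp at hw ⊢
        exact hw.ne'
      · rw [Finset.card_erase_of_mem (Finset.mem_univ _), Finset.card_univ,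
          SimpleGraph.card_neighborFinset_eq_degree, h1]
    rw [← SimpleGraph.mem_neighborFinset, this]
    simpa using huv
  have hn' : (8:ℝ) ≤ n := by exact_mod_cast h8
  have hr' : (1:ℝ) ≤ r := by exact_mod_cast hr1
  have hrn : (r:ℝ) + 1 ≤ n := by
    have : r + 1 ≤ n := by omega
    exact_mod_cast this
  have hn2 : (0:ℝ) < n - 2 := by linarith
  by_contra hc
  push Not at hc
  set c : ℝ := 2 * (r : ℝ) / ((n : ℝ) - 2) with hcdef
  have hcm : c * (n - 2) = 2 * r := by rw [hcdef]; field_simp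
  have hc0 : 0 < c := by rw [hcdef]; positivity
  have hcr : 3 * c ≤ r := by nlinarith
  set s := ∑ u, x u with hs
  have hSv : ∀ v ∈ S, ((n:ℝ) - 2 - μ) * x v = - s := by
    intro v hv
    have h := hE v
    have h2 : ∑ u, (if G.Adj v u then x v + x u else 0)
        = ∑ u, ((x v + x u) - if u = v then 2 * x v else 0) := by
      apply Finset.sum_congr rfl
      intro u _
      by_cases huv : u = v
      · subst huv; simp; ring
      · simp [huv, hadj v hv u huv]
    rw [h2, Finset.sum_sub_distrib, Finset.sum_add_distrib] at h
    simp [hn] at h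
    linarith
  have hpos : 0 < (n:ℝ) - 2 - μ := by nlinarith
  set a := - s / ((n:ℝ) - 2 - μ) with ha
  have hSa : ∀ v ∈ S, x v = a := by
    intro v hv
    rw [ha, eq_div_iff hpos.ne', ← hSv v hv]; ring
  have has : ((n:ℝ) - 2 - μ) * a = - s := by rw [ha]; field_simp
  set t := ∑ u ∈ Sᶜ, x u with ht
  have hst : s = (r + 1) * a + t := by
    rw [hs, ← Finset.sum_add_sum_compl S, Finset.sum_congr rfl hSa]
    simp [hSc, ht]
  have hcc : ((Sᶜ.card : ℕ) : ℝ) = n - (r + 1) := by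
    rw [Finset.card_compl, hn, hSc, Nat.cast_sub (by omega)]; push_cast; ring
  set Y := ∑ u ∈ Sᶜ, x u ^ 2 with hY
  have hCS : t ^ 2 ≤ (n - (r + 1)) * Y := by
    rw [← hcc]; exact sq_sum_le_card_mul_sum_sq
  have hY0 : 0 ≤ Y := Finset.sum_nonneg fun _ _ => sq_nonneg _
  set P := ∑ v ∈ Sᶜ, ∑ u ∈ Sᶜ, x v * (if G.Adj v u then x v + x u else 0) with hP
  have hP0 : 0 ≤ P := by
    have h1 : P = ∑ v ∈ Sᶜ, ∑ u ∈ Sᶜ, x u * (if G.Adj v u then x v + x u else 0) := by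
      rw [hP, Finset.sum_comm]
      refine Finset.sum_congr rfl fun v _ => Finset.sum_congr rfl fun u _ => ?_
      simp only [G.adj_comm u v, add_comm (x u) (x v)]
    have h2 : P + P = ∑ v ∈ Sᶜ, ∑ u ∈ Sᶜ, (if G.Adj v u then (x v + x u)^2 else 0) := by
      conv_lhs => rw [h1]
      nth_rewrite 1 [← h1]
      rw [hP, ← Finset.sum_add_distrib]
      refine Finset.sum_congr rfl fun v _ => ?_
      rw [← Finset.sum_add_distrib]
      refine Finset.sum_congr rfl fun u _ => ?_
      split_ifs <;> ring
    have h3 : 0 ≤ P + P := by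
      rw [h2]
      refine Finset.sum_nonneg fun v _ => Finset.sum_nonneg fun u _ => ?_
      split_ifs <;> positivity
    linarith
  have hmain : (r + 1) * Y + (r + 1) * a * t + P = μ * Y := by
    have h1 : ∀ v ∈ Sᶜ, (r + 1) * x v ^ 2 + (r + 1) * a * x v +
        ∑ u ∈ Sᶜ, x v * (if G.Adj v u then x v + x u else 0) = μ * x v ^ 2 := by
      intro v hv
      have h := hE v
      rw [← Finset.sum_add_sum_compl S] at h
      have h2 : ∑ u ∈ S, (if G.Adj v u then x v + x u else 0) = (r + 1) * (x v + a) := by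
        have : ∀ u ∈ S, (if G.Adj v u then x v + x u else 0) = x v + a := by
          intro u hu
          have hne : v ≠ u := by
            rintro rfl
            exact (Finset.mem_compl.1 hv) hu
          rw [if_pos (hadj u hu v hne).symm, hSa u hu]
        rw [Finset.sum_congr rfl this]
        simp [hSc]
        ring
      rw [h2] at h
      rw [← Finset.mul_sum]
      linear_combination x v * h
    have h2 := Finset.sum_congr rfl h1
    rw [Finset.sum_add_distrib, Finset.sum_add_distrib, ← Finset.mul_sum, ← Finset.mul_sum,
      ← Finset.mul_sum] at h2
    exact h2
  have htd : t = -((n:ℝ) - 2 - μ + (r + 1)) * a := by linarith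
  have hkμ : 0 < (r:ℝ) + 1 - μ := by linarith
  have ha0 : a ≠ 0 := by
    intro ha0
    have hYz : Y = 0 := by
      rw [ha0] at hmain
      nlinarith
    apply hx0
    funext v
    by_cases hv : v ∈ S
    · simp [hSa v hv, ha0]
    · have := (Finset.sum_eq_zero_iff_of_nonneg (fun _ _ => sq_nonneg _)).1 hYz v
        (Finset.mem_compl.2 hv)
      simpa using this
  have ha2 : 0 < a ^ 2 := by positivity
  set w := (n:ℝ) - 2 - μ + (r + 1) with hw
  have hw0 : 0 < w := by linarith
  have hfin : ((r:ℝ) + 1 - μ) * w ≤ (n - (r + 1)) * (r + 1) := by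
    have h1 : ((r:ℝ) + 1 - μ) * Y ≤ (r + 1) * a ^ 2 * w := by
      have : a * t = - (a ^ 2 * w) := by rw [htd]; ring
      nlinarith
    have h2 : ((r:ℝ) + 1 - μ) * t ^ 2 ≤ (n - (r + 1)) * ((r + 1) * a ^ 2 * w) := by
      calc _ ≤ ((r:ℝ) + 1 - μ) * ((n - (r + 1)) * Y) := by gcongr
        _ = (n - (r + 1)) * (((r:ℝ) + 1 - μ) * Y) := by ring
        _ ≤ _ := mul_le_mul_of_nonneg_left h1 (by linarith)
    have h3 : t ^ 2 = w * (w * a ^ 2) := by rw [htd]; ring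
    rw [h3] at h2
    have h4 : 0 < w * a ^ 2 := by positivity
    refine le_of_mul_le_mul_right ?_ h4
    linarith
  have hmono : ((r:ℝ) + 1 - c) * ((n:ℝ) - 2 - c + (r + 1)) ≤ ((r:ℝ) + 1 - μ) * w := by
    rw [hw]
    apply mul_le_mul <;> linarith
  have hf : c ^ 2 - (n + 2 * r) * c + 2 * r * (r + 1) ≤ 0 := by linarith
  have h5 : c ^ 2 - 2 * r - (2 + 2 * r) * c + 2 * r * (r + 1) ≤ 0 := by linarith
  have h6 : (r + 1) * (3 * c) ≤ (r + 1) * (r : ℝ) :=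
    mul_le_mul_of_nonneg_left hcr (by linarith)
  have h7 : (r : ℝ) * 1 ≤ r * r := mul_le_mul_of_nonneg_left hr' (by linarith)
  have h8 : 0 < c ^ 2 := by positivity
  linarith
end
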